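/- arXiv:1803.02550 — 10 statements merged into one kernel-verified Lean document; each statement's English description precedes it below -/
import Mathlib

section
/- For every finite connected nonempty simple graph G, the broadcast number satisfies γ_b(G) ≤ 2·mp(G) + 3, where mp(G) is the multipacking number of G. -/
/-- A dominating broadcast: every vertex `u` is within distance `f v` of some vertex `v`
with `f v ≥ 1`. -/
def isDominatingBroadcast {V : Type*} (G : SimpleGraph V) (f : V → ℕ) : Prop :=
  ∀ u : V, ∃ v : V, 1 ≤ f v ∧ G.dist u v ≤ f v

/-- The broadcast number: minimum cost `∑ v, f v` of a dominating broadcast. -/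
noncomputable def broadcastNumber {V : Type*} [Fintype V] (G : SimpleGraph V) : ℕ :=
  sInf {c : ℕ | ∃ f : V → ℕ, isDominatingBroadcast G f ∧ ∑ v : V, f v = c}

/-- A multipacking: every ball of radius `r ≥ 1` contains at most `r` vertices of `P`. -/
def isMultipacking {V : Type*} (G : SimpleGraph V) (P : Set V) : Prop :=
  ∀ v : V, ∀ r : ℕ, 1 ≤ r → ({u ∈ P | G.dist u v ≤ r}).ncard ≤ r

/-- The multipacking number: maximum size of a multipacking. -/
noncomputable def multipackingNumber {V : Type*} [Fintype V] (G : SimpleGraph V) : ℕ :=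
  sSup {n : ℕ | ∃ P : Set V, isMultipacking G P ∧ P.ncard = n}

/-- The eccentricity of a vertex: the largest distance from it to any vertex. -/
noncomputable def eccentricity {V : Type*} [Fintype V] (G : SimpleGraph V) (v : V) : ℕ :=
  Finset.univ.sup fun u : V => G.dist u v

/-- The radius of a graph: the minimum eccentricity over all vertices. -/
noncomputable def graphRadius {V : Type*} [Fintype V] (G : SimpleGraph V) : ℕ :=
  sInf (Set.range (eccentricity G))

/-- The diameter of a graph: the maximum distance over all pairs of vertices. -/
noncomputable def graphDiameter {V : Type*} [Fintype V] (G : SimpleGraph V) : ℕ :=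
  Finset.univ.sup fun p : V × V => G.dist p.1 p.2

theorem aux_count (k l r : ℤ) (hr : 1 ≤ r) (A B : Finset ℤ)
    (hA : ∀ i ∈ A, -k ≤ i ∧ i ≤ k) (hB : ∀ j ∈ B, 2 ≤ j ∧ j ≤ l)
    (hAA : ∀ i ∈ A, ∀ j ∈ A, 3 * (i - j) ≤ 2 * r)
    (hBB : ∀ i ∈ B, ∀ j ∈ B, 3 * (i - j) ≤ 2 * r)
    (hAB : ∀ i ∈ A, ∀ j ∈ B, 3 * (k + j - |i|) ≤ 2 * r) :
    (A.card : ℤ) + B.card ≤ r := by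
  have single : ∀ S : Finset ℤ, (∀ i ∈ S, ∀ j ∈ S, 3 * (i - j) ≤ 2 * r) → (S.card : ℤ) ≤ r := by
    intro S hS
    rcases S.eq_empty_or_nonempty with rfl | hne
    · simp; omega
    have h1 := hS _ (S.max'_mem hne) _ (S.min'_mem hne)
    have h2 : S ⊆ Finset.Icc (S.min' hne) (S.max' hne) := fun i hi =>
      Finset.mem_Icc.2 ⟨S.min'_le i hi, S.le_max' i hi⟩
    have h3 := Finset.card_le_card h2
    rw [Int.card_Icc] at h3
    have h4 := S.min'_le _ (S.max'_mem hne)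
    omega
  rcases A.eq_empty_or_nonempty with rfl | hAne
  · simpa using single B hBB
  rcases B.eq_empty_or_nonempty with rfl | hBne
  · simpa using single A hAA
  have hJ := B.max'_mem hBne
  have hBc : B ⊆ Finset.Icc 2 (B.max' hBne) := fun i hi =>
      Finset.mem_Icc.2 ⟨(hB i hi).1, B.le_max' i hi⟩
  have hBc := Finset.card_le_card hBc
  rw [Int.card_Icc] at hBc
  have hJ2 := (hB _ hJ).1
  obtain ⟨p, hp, hpm⟩ := Finset.exists_min_image A (fun i => |i|) hAne
  have hpJ := hAB p hp _ hJ
  have ha := A.min'_mem hAne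
  have hb := A.max'_mem hAne
  have hal : ∀ i ∈ A, A.min' hAne ≤ i := fun i hi => A.min'_le i hi
  have hbl : ∀ i ∈ A, i ≤ A.max' hAne := fun i hi => A.le_max' i hi
  generalize A.min' hAne = a at *
  generalize A.max' hAne = b at *
  generalize B.max' hBne = J at *
  have hab := hAA b hb a ha
  have hak := hA a ha
  have hbk := hA b hb
  have hma := hpm a ha
  have hmb := hpm b hb
  have hm0 := abs_nonneg p
  have h_a := hal b hb
  generalize |p| = m at *
  by_cases hs : 0 < a ∨ b < 0
  · have hAc : A ⊆ Finset.Icc a b := fun i hi => Finset.mem_Icc.2 ⟨hal i hi, hbl i hi⟩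
    have hAc := Finset.card_le_card hAc
    rw [Int.card_Icc] at hAc
    rcases abs_cases a with h | h <;> rcases abs_cases b with h' | h' <;> omega
  · have hAc : A ⊆ Finset.Icc a (-m) ∪ Finset.Icc (max m (-m+1)) b := by
      intro i hi
      have h1 := hal i hi
      have h2 := hbl i hi
      have h3 := hpm i hi
      simp only [Finset.mem_union, Finset.mem_Icc]
      rcases abs_cases i with h | h <;> omega
    have hAc := (Finset.card_le_card hAc).trans (Finset.card_union_le _ _)
    rw [Int.card_Icc, Int.card_Icc] at hAc
    rcases abs_cases a with h | h <;> rcases abs_cases b with h' | h' <;> omega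

theorem aux_mp {V : Type*} [Fintype V] (G : SimpleGraph V) (hG : G.Connected)
    (k l : ℕ) (g h : ℤ → V)
    (hgg : ∀ i j : ℤ, -k ≤ i → i ≤ k → -k ≤ j → j ≤ k → 3 * (i - j) ≤ G.dist (g i) (g j))
    (hhh : ∀ i j : ℤ, 2 ≤ i → i ≤ l → 2 ≤ j → j ≤ l → 3 * (i - j) ≤ G.dist (h i) (h j))
    (hgh : ∀ i j : ℤ, -k ≤ i → i ≤ k → 2 ≤ j → j ≤ l →
      3 * (k + j - |i|) ≤ G.dist (g i) (h j)) :
    2 * k + 1 + (l - 1) ≤ multipackingNumber G := by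
  classical
  set A0 : Finset ℤ := Finset.Icc (-k) k with hA0
  set B0 : Finset ℤ := Finset.Icc 2 l with hB0
  have gi : Set.InjOn g A0 := by
    intro i hi j hj hij
    simp only [hA0, Finset.coe_Icc, Set.mem_Icc] at hi hj
    have h1 := hgg i j hi.1 hi.2 hj.1 hj.2
    have h2 := hgg j i hj.1 hj.2 hi.1 hi.2
    rw [hij] at h1 h2
    simp at h1 h2
    omega
  have hi : Set.InjOn h B0 := by
    intro i hi j hj hij
    simp only [hB0, Finset.coe_Icc, Set.mem_Icc] at hi hj
    have h1 := hhh i j hi.1 hi.2 hj.1 hj.2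
    have h2 := hhh j i hj.1 hj.2 hi.1 hi.2
    rw [hij] at h1 h2
    simp at h1 h2
    omega
  have dj : Disjoint (A0.image g) (B0.image h) := by
    rw [Finset.disjoint_left]
    intro x hx hy
    simp only [hA0, hB0, Finset.mem_image, Finset.mem_Icc] at hx hy
    obtain ⟨i, hi, rfl⟩ := hx
    obtain ⟨j, hj, hij⟩ := hy
    have h1 := hgh i j hi.1 hi.2 hj.1 hj.2
    rw [hij] at h1
    simp at h1
    rcases abs_cases i with h | h <;> omega
  apply le_csSup
  · refine ⟨Fintype.card V, ?_⟩
    rintro n ⟨P, -, rfl⟩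
    rw [← Nat.card_eq_fintype_card]
    exact Set.ncard_le_card P
  refine ⟨((A0.image g ∪ B0.image h : Finset V) : Set V), ?_, ?_⟩
  · intro w r hr
    set A := A0.filter (fun i => G.dist (g i) w ≤ r) with hA
    set B := B0.filter (fun i => G.dist (h i) w ≤ r) with hB
    have hsub : {u ∈ ((A0.image g ∪ B0.image h : Finset V) : Set V) | G.dist u w ≤ r} ⊆
        ((A.image g ∪ B.image h : Finset V) : Set V) := by
      rintro u ⟨hu, hd⟩
      simp only [Finset.coe_union, Finset.coe_image, Set.mem_union, Set.mem_image,
        Finset.mem_coe, hA, hB, Finset.mem_filter] at hu ⊢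
      rcases hu with ⟨i, hi, rfl⟩ | ⟨i, hi, rfl⟩
      · exact Or.inl ⟨i, ⟨hi, hd⟩, rfl⟩
      · exact Or.inr ⟨i, ⟨hi, hd⟩, rfl⟩
    have h1 := Set.ncard_le_ncard hsub
    rw [Set.ncard_coe_finset] at h1
    have h2 := Finset.card_union_le (A.image g) (B.image h)
    have h3 := Finset.card_image_le (s := A) (f := g)
    have h4 := Finset.card_image_le (s := B) (f := h)
    have tri : ∀ x y, G.dist x w ≤ r → G.dist y w ≤ r → (G.dist x y : ℤ) ≤ 2 * r := by
      intro x y hx hy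
      have := hG.dist_triangle (u := x) (v := w) (w := y)
      rw [G.dist_comm (u := w)] at this
      omega
    have := aux_count k l r (by omega) A B
      (by intro i hi; simpa [hA, hA0] using (Finset.mem_filter.1 hi).1)
      (by intro i hi; simpa [hB, hB0] using (Finset.mem_filter.1 hi).1)
      (by
        intro i hi j hj
        simp only [hA, hA0, Finset.mem_filter, Finset.mem_Icc] at hi hj
        exact (hgg i j hi.1.1 hi.1.2 hj.1.1 hj.1.2).trans (tri _ _ hi.2 hj.2))
      (by
        intro i hi j hj
        simp only [hB, hB0, Finset.mem_filter, Finset.mem_Icc] at hi hj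
        exact (hhh i j hi.1.1 hi.1.2 hj.1.1 hj.1.2).trans (tri _ _ hi.2 hj.2))
      (by
        intro i hi j hj
        simp only [hA, hA0, hB, hB0, Finset.mem_filter, Finset.mem_Icc] at hi hj
        exact (hgh i j hi.1.1 hi.1.2 hj.1.1 hj.1.2).trans (tri _ _ hi.2 hj.2))
    omega
  · rw [Set.ncard_coe_finset, Finset.card_union_of_disjoint dj, Finset.card_image_of_injOn gi,
      Finset.card_image_of_injOn hi, Int.card_Icc, Int.card_Icc]
    omega

theorem aux_geo {V : Type*} (G : SimpleGraph V) (hG : G.Connected) (u v : V) :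
    ∃ p : ℕ → V, p 0 = u ∧ p (G.dist u v) = v ∧
      ∀ i j, i ≤ j → j ≤ G.dist u v → G.dist (p i) (p j) = j - i := by
  obtain ⟨w, hw⟩ := hG.exists_walk_length_eq_dist u v
  have up : ∀ i n, i + n ≤ w.length → G.dist (w.getVert i) (w.getVert (i + n)) ≤ n := by
    intro i n
    induction n with
    | zero => intro _; simp
    | succ n ih =>
      intro hn
      have h1 := ih (by omega)
      have h2 := w.adj_getVert_succ (i := i + n) (by omega)
      have h3 := SimpleGraph.dist_eq_one_iff_adj.2 h2
      have h4 := hG.dist_triangle (u := w.getVert i) (v := w.getVert (i + n))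
        (w := w.getVert (i + n + 1))
      rw [← add_assoc]
      omega
  refine ⟨w.getVert, by simp, by rw [← hw]; simp, ?_⟩
  intro i j hij hj
  have h1 := up 0 i (by omega)
  have h2 := up i (j - i) (by omega)
  have h3 := up j (w.length - j) (by omega)
  rw [show i + (j - i) = j by omega] at h2
  rw [show j + (w.length - j) = w.length by omega, SimpleGraph.Walk.getVert_length] at h3
  rw [Nat.zero_add, SimpleGraph.Walk.getVert_zero] at h1
  have h4 := hG.dist_triangle (u := u) (v := w.getVert i) (w := v)
  have h5 := hG.dist_triangle (u := w.getVert i) (v := w.getVert j) (w := v)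
  omega

/-- For every finite connected nonempty simple graph `G`, `γ_b(G) ≤ 2·mp(G) + 3`. -/
theorem broadcast_le_two_mul_multipacking_add_three
    {V : Type*} [Fintype V] [Nonempty V] (G : SimpleGraph V) (hG : G.Connected) :
    broadcastNumber G ≤ 2 * multipackingNumber G + 3 := by
  classical
  obtain ⟨⟨u, v⟩, huv⟩ := Finite.exists_max (fun p : V × V => G.dist p.1 p.2)
  obtain ⟨p, -, -, hp⟩ := aux_geo G hG u v
  have hD : ∀ a b, G.dist a b ≤ G.dist u v := fun a b => huv (a, b)
  clear huv
  generalize G.dist u v = D at *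
  obtain ⟨k, hk⟩ : ∃ k, k = D / 6 := ⟨_, rfl⟩
  obtain ⟨x, hx⟩ : ∃ x, x = p (3 * k) := ⟨_, rfl⟩
  obtain ⟨y, hy⟩ := Finite.exists_max (fun a : V => G.dist x a)
  obtain ⟨q, hq0, -, hq⟩ := aux_geo G hG x y
  have he : 3 * k ≤ G.dist x y := by
    have h1 := hp 0 (3 * k) (by omega) (by omega)
    have h2 := hy (p 0)
    rw [G.dist_comm, ← hx] at h1
    omega
  have heD := hD x y
  generalize G.dist x y = e at *
  obtain ⟨l, hl⟩ : ∃ l, l = (e - 3 * k) / 3 := ⟨_, rfl⟩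
  have hmp := aux_mp G hG k l (fun i => p (3 * (i + k)).toNat) (fun j => q (3 * (k + j)).toNat)
    (by
      intro i j hi1 hi2 hj1 hj2
      rcases le_total i j with hij | hij
      · omega
      · rw [G.dist_comm, hp _ _ (by omega) (by omega)]
        omega)
    (by
      intro i j hi1 hi2 hj1 hj2
      rcases le_total i j with hij | hij
      · omega
      · rw [G.dist_comm, hq _ _ (by omega) (by omega)]
        omega)
    (by
      intro i j hi1 hi2 hj1 hj2
      have h1 := hq 0 (3 * (k + j)).toNat (by omega) (by omega)
      have h2 : (G.dist x (p (3 * (i + k)).toNat) : ℤ) = 3 * |i| := by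
        rw [hx]
        rcases abs_cases i with h | h
        · rw [hp _ _ (by omega) (by omega)]; omega
        · rw [G.dist_comm, hp _ _ (by omega) (by omega)]; omega
      have h3 := hG.dist_triangle (u := x) (v := p (3 * (i + k)).toNat)
        (w := q (3 * (k + j)).toNat)
      rw [hq0] at h1
      omega)
  have hb : broadcastNumber G ≤ max e 1 := by
    apply Nat.sInf_le
    refine ⟨Pi.single x (max e 1), ?_, ?_⟩
    · intro a
      refine ⟨x, by simp, ?_⟩
      have := hy a
      rw [G.dist_comm]
      simp only [Pi.single_eq_same]
      omega
    · simp
  omega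
end

section
/- Let G be a finite connected simple graph, k a positive integer, and (u_0, u_1, …, u_{3k}) an isometric path in G. Then the set P = {u_{3i} : 0 ≤ i ≤ k} is a multipacking of G of size k+1; in particular mp(G) ≥ k+1. -/
/-- Every third vertex of an isometric path of length `3k` forms a multipacking of size
`k + 1`; in particular `mp(G) ≥ k + 1`. -/
theorem third_vertices_of_isometric_path_isMultipacking
    {V : Type*} [Fintype V] (G : SimpleGraph V) (hG : G.Connected)
    (k : ℕ) (hk : 1 ≤ k) (u : ℕ → V)
    (hiso : ∀ i j : ℕ, i ≤ 3 * k → j ≤ 3 * k →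
      G.dist (u i) (u j) = max i j - min i j) :
    isMultipacking G {w : V | ∃ i ≤ k, w = u (3 * i)} ∧
    ({w : V | ∃ i ≤ k, w = u (3 * i)} : Set V).ncard = k + 1 ∧
    k + 1 ≤ multipackingNumber G := by
  classical
  have h1 : isMultipacking G {w : V | ∃ i ≤ k, w = u (3 * i)} := by
    intro v r hr
    let I : Finset ℕ := (Finset.range (k + 1)).filter (fun i => G.dist (u (3 * i)) v ≤ r)
    have hsub : {w ∈ {w : V | ∃ i ≤ k, w = u (3 * i)} | G.dist w v ≤ r} ⊆
        ((I.image (fun i => u (3 * i)) : Finset V) : Set V) := by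
      rintro w ⟨⟨i, hi, rfl⟩, hd⟩
      simp only [Finset.coe_image, Set.mem_image, Finset.mem_coe]
      exact ⟨i, by simp only [I, Finset.mem_filter, Finset.mem_range]; exact ⟨by omega, hd⟩, rfl⟩
    have hI : I.card ≤ r := by
      rcases I.eq_empty_or_nonempty with h | h
      · simp [h]
      · have hsub2 : I ⊆ Finset.Icc (I.min' h) (I.min' h + 2 * r / 3) := by
          intro b hb
          have hab := I.min'_le b hb
          have ha := I.min'_mem h
          generalize I.min' h = a at *
          simp only [I, Finset.mem_filter, Finset.mem_range] at ha hb
          have ht := hG.dist_triangle (u := u (3 * a)) (v := v) (w := u (3 * b))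
          rw [hiso _ _ (by omega) (by omega), G.dist_comm (u := v)] at ht
          simp only [Finset.mem_Icc]
          omega
        have := Finset.card_le_card hsub2
        rw [Nat.card_Icc] at this
        omega
    calc _ ≤ _ := Set.ncard_le_ncard hsub (Finset.finite_toSet _)
      _ = _ := Set.ncard_coe_finset _
      _ ≤ _ := Finset.card_image_le
      _ ≤ r := hI
  have h2 : ({w : V | ∃ i ≤ k, w = u (3 * i)} : Set V).ncard = k + 1 := by
    have he : ({w : V | ∃ i ≤ k, w = u (3 * i)} : Set V) =
        (((Finset.range (k + 1)).image (fun i => u (3 * i)) : Finset V) : Set V) := by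
      ext w
      simp only [Set.mem_setOf_eq, Finset.coe_image, Set.mem_image, Finset.mem_coe,
        Finset.mem_range]
      constructor
      · rintro ⟨i, hi, rfl⟩
        exact ⟨i, by omega, rfl⟩
      · rintro ⟨i, hi, rfl⟩
        exact ⟨i, by omega, rfl⟩
    rw [he, Set.ncard_coe_finset, Finset.card_image_of_injOn, Finset.card_range]
    intro i hi j hj hij
    simp only [Finset.coe_range, Set.mem_Iio] at hi hj
    have := hiso (3 * i) (3 * j) (by omega) (by omega)
    simp only at hij
    rw [hij, SimpleGraph.dist_self] at this
    omega
  refine ⟨h1, h2, le_csSup ⟨Fintype.card V, ?_⟩ ⟨_, h1, h2⟩⟩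
  rintro n ⟨P, -, rfl⟩
  rw [← Nat.card_eq_fintype_card]
  exact Set.ncard_le_card P
end

section
/- For every finite connected nonempty simple graph G, the multipacking number satisfies mp(G) ≥ ⌈(diam(G) + 1)/3⌉, where diam(G) is the diameter of G. -/
/-- For every finite connected nonempty simple graph `G`, `mp(G) ≥ ⌈(diam(G)+1)/3⌉`.
(Here `⌈(diam(G)+1)/3⌉ = (graphDiameter G + 1 + 2)/3` in `ℕ`.) -/
theorem multipacking_ge_ceil_diam_add_one_div_three
    {V : Type*} [Fintype V] [Nonempty V] (G : SimpleGraph V) (hG : G.Connected) :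
    (graphDiameter G + 1 + 2) / 3 ≤ multipackingNumber G := by
  classical
  obtain ⟨⟨a, b⟩, -, hab⟩ := Finset.exists_mem_eq_sup (Finset.univ : Finset (V × V))
    Finset.univ_nonempty (fun p : V × V => G.dist p.1 p.2)
  have hd : graphDiameter G = G.dist a b := hab
  rw [hd]
  obtain ⟨p, hp⟩ := hG.exists_walk_length_eq_dist a b
  have hlev : ∀ k, k ≤ G.dist a b → G.dist a (p.getVert k) = k := by
    intro k hk
    have h1 := SimpleGraph.dist_le (p.take k)
    have h2 := SimpleGraph.dist_le (p.drop k)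
    have h3 := hG.dist_triangle (u := a) (v := p.getVert k) (w := b)
    rw [SimpleGraph.Walk.take_length] at h1
    rw [SimpleGraph.Walk.drop_length] at h2
    omega
  set n := G.dist a b / 3 + 1 with hn
  set P : Set V := (fun i => p.getVert (3 * i)) '' Set.Iio n with hP
  have hx : ∀ i ∈ Set.Iio n, G.dist a (p.getVert (3 * i)) = 3 * i := by
    intro i hi
    simp only [Set.mem_Iio] at hi
    exact hlev _ (by omega)
  have hcard : P.ncard = n := by
    rw [hP, Set.ncard_image_of_injOn]
    · rw [← Finset.coe_Iio, Set.ncard_coe_finset, Nat.card_Iio]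
    · intro i hi j hj hij
      have h1 := hx i hi
      have h2 := hx j hj
      simp only at hij
      rw [hij] at h1
      omega
  have hmp : isMultipacking G P := by
    intro v r hr
    have key : ({u ∈ P | G.dist u v ≤ r}).ncard ≤
        ((Finset.Icc ((G.dist a v - r + 2) / 3) ((G.dist a v + r) / 3) : Finset ℕ) : Set ℕ).ncard := by
      apply Set.ncard_le_ncard_of_injOn (fun u => G.dist a u / 3)
      · rintro u ⟨⟨i, hi, rfl⟩, hu⟩
        have h1 := hx i hi
        have h2 := hG.dist_triangle (u := a) (v := p.getVert (3 * i)) (w := v)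
        have h3 := hG.dist_triangle (u := a) (v := v) (w := p.getVert (3 * i))
        rw [SimpleGraph.dist_comm (u := v)] at h3
        simp only [Finset.coe_Icc, Set.mem_Icc] at hu ⊢
        omega
      · rintro u ⟨⟨i, hi, rfl⟩, -⟩ w ⟨⟨j, hj, rfl⟩, -⟩ h
        have h1 := hx i hi
        have h2 := hx j hj
        simp only at h
        have : i = j := by omega
        rw [this]
    rw [Set.ncard_coe_finset, Nat.card_Icc] at key
    omega
  have : (G.dist a b + 1 + 2) / 3 = n := by omega
  rw [this]
  apply le_csSup
  · refine ⟨Fintype.card V, ?_⟩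
    rintro m ⟨Q, -, rfl⟩
    rw [← Nat.card_eq_fintype_card]
    exact Set.ncard_le_card Q
  · exact ⟨P, hmp, hcard⟩
end

section
/- Let G be a finite connected simple graph and let k and k' be positive integers with k' ≤ k. If there exist four vertices x, y, u, v of G such that dist_G(x,u) = dist_G(x,v) = 3k, dist_G(u,v) = 6k, and dist_G(x,y) = 3k + 3k', then mp(G) ≥ 2k + k'. -/
lemma exists_vertex_between_mp {V : Type*} (G : SimpleGraph V) (hG : G.Connected) (a b : V) (i : ℕ)
    (hi : i ≤ G.dist a b) : ∃ w, G.dist a w = i ∧ G.dist w b + i = G.dist a b := by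
  obtain ⟨p, hp⟩ := hG.exists_walk_length_eq_dist a b
  have h1 := SimpleGraph.dist_le (p.take i)
  have h2 := SimpleGraph.dist_le (p.drop i)
  have h3 := hG.dist_triangle (u := a) (v := p.getVert i) (w := b)
  rw [SimpleGraph.Walk.take_length] at h1
  rw [SimpleGraph.Walk.drop_length] at h2
  refine ⟨p.getVert i, ?_, ?_⟩ <;> omega

lemma card_range_bound (S : Finset ℕ) :
    S.card = 0 ∨ ∃ a ∈ S, ∃ b ∈ S, a ≤ b ∧ S.card + a ≤ b + 1 := by
  rcases S.eq_empty_or_nonempty with h | h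
  · left; simp [h]
  · right
    refine ⟨S.min' h, S.min'_mem h, S.max' h, S.max'_mem h, S.min'_le _ (S.max'_mem h), ?_⟩
    have hs : S ⊆ Finset.Icc (S.min' h) (S.max' h) := fun z hz =>
      Finset.mem_Icc.2 ⟨S.min'_le _ hz, S.le_max' _ hz⟩
    have := Finset.card_le_card hs
    have h2 := S.min'_le _ (S.max'_mem h)
    rw [Nat.card_Icc] at this
    omega

/-- If `x, y, u, v` satisfy `d(x,u) = d(x,v) = 3k`, `d(u,v) = 6k` and `d(x,y) = 3k + 3k'`
with `1 ≤ k' ≤ k`, then `mp(G) ≥ 2k + k'`. -/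
theorem multipacking_ge_of_four_vertices
    {V : Type*} [Fintype V] (G : SimpleGraph V) (hG : G.Connected)
    (k k' : ℕ) (hk' : 1 ≤ k') (hk'k : k' ≤ k)
    (x y u v : V)
    (hxu : G.dist x u = 3 * k) (hxv : G.dist x v = 3 * k)
    (huv : G.dist u v = 6 * k) (hxy : G.dist x y = 3 * k + 3 * k') :
    2 * k + k' ≤ multipackingNumber G := by
  classical
  have hdist : ∀ b : V, ∃ p : ℕ → V, ∀ i, i ≤ G.dist x b →
      G.dist x (p i) = i ∧ G.dist (p i) b + i = G.dist x b := by
    intro b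
    have : ∀ i, ∃ w, i ≤ G.dist x b → G.dist x w = i ∧ G.dist w b + i = G.dist x b := by
      intro i
      by_cases hi : i ≤ G.dist x b
      · obtain ⟨w, hw⟩ := exists_vertex_between_mp G hG x b i hi
        exact ⟨w, fun _ => hw⟩
      · exact ⟨x, fun h => absurd h hi⟩
    choose p hp using this
    exact ⟨p, hp⟩
  obtain ⟨p, hp⟩ := hdist u
  obtain ⟨p', hp'⟩ := hdist v
  obtain ⟨q, hq⟩ := hdist y
  rw [hxu] at hp
  rw [hxv] at hp'
  rw [hxy] at hq
  have tri : ∀ a b c : V, G.dist a c ≤ G.dist a b + G.dist b c := fun a b c => hG.dist_triangle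
  have low : ∀ a b : V, G.dist x b ≤ G.dist x a + G.dist a b := fun a b => tri x a b
  have opp : ∀ i j, i ≤ 3 * k → j ≤ 3 * k → i + j ≤ G.dist (p i) (p' j) := by
    intro i j hi hj
    have h1 := tri u (p i) v
    have h2 := tri (p i) (p' j) v
    have h3 := (hp i hi).2
    have h4 := (hp' j hj).2
    rw [G.dist_comm (u := u) (v := p i)] at h1
    omega
  let IA := Finset.Icc 1 k
  let IC := Finset.Icc (k+1) (k+k')
  let A : ℕ → V := fun i => p (3 * i)
  let B : ℕ → V := fun i => p' (3 * i)
  let C : ℕ → V := fun i => q (3 * i)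
  have hA : ∀ i ∈ IA, 1 ≤ i ∧ i ≤ k ∧ G.dist x (A i) = 3 * i := by
    intro i hi
    have := Finset.mem_Icc.1 hi
    exact ⟨this.1, this.2, (hp (3*i) (by omega)).1⟩
  have hB : ∀ i ∈ IA, 1 ≤ i ∧ i ≤ k ∧ G.dist x (B i) = 3 * i := by
    intro i hi
    have := Finset.mem_Icc.1 hi
    exact ⟨this.1, this.2, (hp' (3*i) (by omega)).1⟩
  have hC : ∀ i ∈ IC, k + 1 ≤ i ∧ i ≤ k + k' ∧ G.dist x (C i) = 3 * i := by
    intro i hi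
    have := Finset.mem_Icc.1 hi
    exact ⟨this.1, this.2, (hq (3*i) (by omega)).1⟩
  have hAB : ∀ i ∈ IA, ∀ j ∈ IA, 3 * i + 3 * j ≤ G.dist (A i) (B j) := by
    intro i hi j hj
    have h1 := hA i hi
    have h2 := hB j hj
    exact opp _ _ (by omega) (by omega)
  let P : Finset V := (IA.image A ∪ IA.image B) ∪ IC.image C
  have cP : P.card = 2 * k + k' := by
    have c1 : (IA.image A).card = k := by
      rw [Finset.card_image_of_injOn]
      · simp [IA]
      · intro i hi j hj h
        have h1 := (hA i hi).2.2
        have h2 := (hA j hj).2.2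
        have h : A i = A j := h
        rw [h] at h1; omega
    have c2 : (IA.image B).card = k := by
      rw [Finset.card_image_of_injOn]
      · simp [IA]
      · intro i hi j hj h
        have h1 := (hB i hi).2.2
        have h2 := (hB j hj).2.2
        have h : B i = B j := h
        rw [h] at h1; omega
    have c3 : (IC.image C).card = k' := by
      rw [Finset.card_image_of_injOn]
      · simp [IC]
      · intro i hi j hj h
        have h1 := (hC i hi).2.2
        have h2 := (hC j hj).2.2
        have h : C i = C j := h
        rw [h] at h1; omega
    have d1 : Disjoint (IA.image A) (IA.image B) := by
      rw [Finset.disjoint_left]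
      intro z hz hz'
      obtain ⟨i, hi, rfl⟩ := Finset.mem_image.1 hz
      obtain ⟨j, hj, h⟩ := Finset.mem_image.1 hz'
      have h1 := hAB i hi j hj
      have h2 := hA i hi
      rw [h, SimpleGraph.dist_self] at h1
      omega
    have d2 : Disjoint (IA.image A ∪ IA.image B) (IC.image C) := by
      rw [Finset.disjoint_left]
      intro z hz hz'
      obtain ⟨j, hj, rfl⟩ := Finset.mem_image.1 hz'
      have h3 := hC j hj
      rcases Finset.mem_union.1 hz with hz | hz
      · obtain ⟨i, hi, h⟩ := Finset.mem_image.1 hz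
        have h2 := hA i hi
        rw [h] at h2
        omega
      · obtain ⟨i, hi, h⟩ := Finset.mem_image.1 hz
        have h2 := hB i hi
        rw [h] at h2
        omega
    rw [Finset.card_union_of_disjoint d2, Finset.card_union_of_disjoint d1, c1, c2, c3]
    omega
  have hmp : isMultipacking G (P : Set V) := by
    intro c r hr
    by_cases hrk : 3 * k ≤ r
    · have h1 : ({w ∈ (P : Set V) | G.dist w c ≤ r}).ncard ≤ (P : Set V).ncard :=
        Set.ncard_le_ncard (fun w hw => hw.1) P.finite_toSet
      rw [Set.ncard_coe_finset, cP] at h1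
      omega
    · let SA := IA.filter fun i => G.dist (A i) c ≤ r
      let SB := IA.filter fun i => G.dist (B i) c ≤ r
      let SC := IC.filter fun i => G.dist (C i) c ≤ r
      have hsub : {w ∈ (P : Set V) | G.dist w c ≤ r} ⊆
          (((SA.image A ∪ SB.image B) ∪ SC.image C : Finset V) : Set V) := by
        rintro w ⟨hw, hwr⟩
        have hw : w ∈ P := hw
        rw [Finset.mem_coe]
        rcases Finset.mem_union.1 hw with hw | hw
        · rcases Finset.mem_union.1 hw with hw | hw
          · obtain ⟨i, hi, rfl⟩ := Finset.mem_image.1 hw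
            exact Finset.mem_union_left _ (Finset.mem_union_left _
              (Finset.mem_image_of_mem _ (Finset.mem_filter.2 ⟨hi, hwr⟩)))
          · obtain ⟨i, hi, rfl⟩ := Finset.mem_image.1 hw
            exact Finset.mem_union_left _ (Finset.mem_union_right _
              (Finset.mem_image_of_mem _ (Finset.mem_filter.2 ⟨hi, hwr⟩)))
        · obtain ⟨i, hi, rfl⟩ := Finset.mem_image.1 hw
          exact Finset.mem_union_right _
              (Finset.mem_image_of_mem _ (Finset.mem_filter.2 ⟨hi, hwr⟩))
      have h1 := Set.ncard_le_ncard hsub (Finset.finite_toSet _)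
      rw [Set.ncard_coe_finset] at h1
      have h2 := Finset.card_union_le (SA.image A ∪ SB.image B) (SC.image C)
      have h3 := Finset.card_union_le (SA.image A) (SB.image B)
      have h4 : (SA.image A).card ≤ SA.card := Finset.card_image_le
      have h5 : (SB.image B).card ≤ SB.card := Finset.card_image_le
      have h6 : (SC.image C).card ≤ SC.card := Finset.card_image_le
      refine h1.trans (h2.trans ?_)
      have two : ∀ a b, G.dist a c ≤ r → G.dist b c ≤ r → G.dist a b ≤ 2 * r := by
        intro a b ha hb
        have := tri a c b
        rw [G.dist_comm (u := c) (v := b)] at this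
        omega
      have two' : ∀ a b, G.dist a c ≤ r → G.dist b c ≤ r →
          G.dist x b ≤ G.dist x a + 2 * r := by
        intro a b ha hb
        have := two a b ha hb
        have := low a b
        omega
      have gA : ∀ i ∈ SA, 1 ≤ i ∧ i ≤ k ∧ G.dist x (A i) = 3 * i := fun i hi =>
        hA i (Finset.mem_filter.1 hi).1
      have gB : ∀ i ∈ SB, 1 ≤ i ∧ i ≤ k ∧ G.dist x (B i) = 3 * i := fun i hi =>
        hB i (Finset.mem_filter.1 hi).1
      have gC : ∀ i ∈ SC, k + 1 ≤ i ∧ i ≤ k + k' ∧ G.dist x (C i) = 3 * i := fun i hi =>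
        hC i (Finset.mem_filter.1 hi).1
      have fAA : ∀ i ∈ SA, ∀ j ∈ SA, 3 * j ≤ 3 * i + 2 * r := by
        intro i hi j hj
        have := two' _ _ (Finset.mem_filter.1 hi).2 (Finset.mem_filter.1 hj).2
        rwa [(gA i hi).2.2, (gA j hj).2.2] at this
      have fBB : ∀ i ∈ SB, ∀ j ∈ SB, 3 * j ≤ 3 * i + 2 * r := by
        intro i hi j hj
        have := two' _ _ (Finset.mem_filter.1 hi).2 (Finset.mem_filter.1 hj).2
        rwa [(gB i hi).2.2, (gB j hj).2.2] at this
      have fCC : ∀ i ∈ SC, ∀ j ∈ SC, 3 * j ≤ 3 * i + 2 * r := by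
        intro i hi j hj
        have := two' _ _ (Finset.mem_filter.1 hi).2 (Finset.mem_filter.1 hj).2
        rwa [(gC i hi).2.2, (gC j hj).2.2] at this
      have fAC : ∀ i ∈ SA, ∀ j ∈ SC, 3 * j ≤ 3 * i + 2 * r := by
        intro i hi j hj
        have := two' _ _ (Finset.mem_filter.1 hi).2 (Finset.mem_filter.1 hj).2
        rwa [(gA i hi).2.2, (gC j hj).2.2] at this
      have fBC : ∀ i ∈ SB, ∀ j ∈ SC, 3 * j ≤ 3 * i + 2 * r := by
        intro i hi j hj
        have := two' _ _ (Finset.mem_filter.1 hi).2 (Finset.mem_filter.1 hj).2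
        rwa [(gB i hi).2.2, (gC j hj).2.2] at this
      have fAB : ∀ i ∈ SA, ∀ j ∈ SB, 3 * i + 3 * j ≤ 2 * r := by
        intro i hi j hj
        have := two _ _ (Finset.mem_filter.1 hi).2 (Finset.mem_filter.1 hj).2
        exact (hAB i (Finset.mem_filter.1 hi).1 j (Finset.mem_filter.1 hj).1).trans this
      suffices SA.card + SB.card + SC.card ≤ r by omega
      clear h1 h2 h3 h4 h5 h6 hsub
      rcases card_range_bound SA with eA | ⟨a1, ha1, a2, ha2, la, ea⟩ <;>
      rcases card_range_bound SB with eB | ⟨b1, hb1, b2, hb2, lb, eb⟩ <;>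
      rcases card_range_bound SC with eC | ⟨c1, hc1, c2, hc2, lc, ec⟩
      · omega
      · have := fCC c1 hc1 c2 hc2
        omega
      · have := fBB b1 hb1 b2 hb2
        omega
      · have := fBC b1 hb1 c2 hc2
        have := gB b2 hb2
        have := gC c1 hc1
        omega
      · have := fAA a1 ha1 a2 ha2
        omega
      · have := fAC a1 ha1 c2 hc2
        have := gA a2 ha2
        have := gC c1 hc1
        omega
      · have := fAB a2 ha2 b2 hb2
        have := gA a1 ha1
        have := gB b1 hb1
        omega
      · have := fAB a2 ha2 b2 hb2
        have := gA a1 ha1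
        have := gB b1 hb1
        have := gC c1 hc1
        have := fAC a1 ha1 c2 hc2
        omega
  refine le_csSup ?_ ⟨P, hmp, by rw [Set.ncard_coe_finset, cP]⟩
  refine ⟨Fintype.card V, ?_⟩
  rintro n ⟨Q, -, rfl⟩
  rw [← Nat.card_eq_fintype_card]
  exact Set.ncard_le_card Q
end

section
/- Let G be a finite connected nonempty simple graph. If mp(G) = 3, then γ_b(G) ≤ 6. -/
lemma exists_dist_between {V : Type*} (G : SimpleGraph V) (hG : G.Connected) (a b : V) (k : ℕ)
    (hk : k ≤ G.dist a b) : ∃ c, G.dist a c = k ∧ G.dist c b = G.dist a b - k := by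
  obtain ⟨p, hp⟩ := hG.exists_walk_length_eq_dist a b
  refine ⟨p.getVert k, ?_⟩
  have h1 := SimpleGraph.dist_le (p.take k)
  have h2 := SimpleGraph.dist_le (p.drop k)
  have h3 := hG.dist_triangle (u := a) (v := p.getVert k) (w := b)
  rw [SimpleGraph.Walk.take_length] at h1
  rw [SimpleGraph.Walk.drop_length] at h2
  omega

lemma four_multipacking {V : Type*} (G : SimpleGraph V) (hG : G.Connected) (a b c u : V)
    (hab : G.dist a b = 7) (hac : G.dist a c = 3) (hcb : G.dist c b = 4)
    (hu : 7 ≤ G.dist c u) :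
    isMultipacking G ({a, b, c, u} : Set V) ∧ ({a, b, c, u} : Set V).ncard = 4 := by
  classical
  have tri : ∀ x y z : V, G.dist x y ≤ G.dist x z + G.dist y z := fun x y z => by
    rw [G.dist_comm (u := y)]; exact hG.dist_triangle
  have hau : 4 ≤ G.dist a u := by
    have := tri c u a
    rw [G.dist_comm (u := c) (v := a), G.dist_comm (u := u) (v := a)] at this; omega
  have hbu : 3 ≤ G.dist b u := by
    have := tri c u b
    rw [G.dist_comm (u := u) (v := b)] at this; omega
  have n1 : a ≠ b := by rintro rfl; simp at hab
  have n2 : a ≠ c := by rintro rfl; simp at hac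
  have n3 : c ≠ b := by rintro rfl; simp at hcb
  have n4 : c ≠ u := by rintro rfl; simp at hu
  have n5 : a ≠ u := by rintro rfl; simp at hau
  have n6 : b ≠ u := by rintro rfl; simp at hbu
  constructor
  · intro v r hr
    have e : {w ∈ ({a, b, c, u} : Set V) | G.dist w v ≤ r} =
        ((({a, b, c, u} : Finset V).filter (fun w => G.dist w v ≤ r) : Finset V) : Set V) := by
      ext w; simp
    rw [e, Set.ncard_coe_finset, Finset.card_filter, Finset.sum_insert (by simp [n1, n2, n5]),
      Finset.sum_insert (by simp [n3.symm, n6]), Finset.sum_insert (by simp [n4]),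
      Finset.sum_singleton]
    have t1 := tri a b v
    have t2 := tri a c v
    have t3 := tri c b v
    have t4 := tri c u v
    have t5 := tri a u v
    have t6 := tri b u v
    split_ifs <;> omega
  · have e : ({a, b, c, u} : Set V) = (({a, b, c, u} : Finset V) : Set V) := by simp
    rw [e, Set.ncard_coe_finset, Finset.card_insert_of_notMem (by simp [n1, n2, n5]),
      Finset.card_insert_of_notMem (by simp [n3.symm, n6]),
      Finset.card_insert_of_notMem (by simp [n4]), Finset.card_singleton]

/-- If `mp(G) = 3` then `γ_b(G) ≤ 6`. -/
theorem broadcast_le_six_of_multipacking_eq_three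
    {V : Type*} [Fintype V] [Nonempty V] (G : SimpleGraph V) (hG : G.Connected)
    (h : multipackingNumber G = 3) :
    broadcastNumber G ≤ 6 := by
  classical
  by_contra hb
  have far : ∀ v : V, ∃ u, 7 ≤ G.dist v u := by
    intro v
    by_contra hv
    push Not at hv
    apply hb
    refine Nat.sInf_le ⟨fun w => if w = v then 6 else 0, ?_, by simp⟩
    intro u
    refine ⟨v, by simp, ?_⟩
    have := hv u
    rw [G.dist_comm]
    simp only [if_true]
    omega
  obtain ⟨a⟩ := ‹Nonempty V›
  obtain ⟨b', hb'⟩ := far a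
  obtain ⟨b, hab, -⟩ := exists_dist_between G hG a b' 7 hb'
  obtain ⟨c, hac, hcb⟩ := exists_dist_between G hG a b 3 (by omega)
  obtain ⟨u, hu⟩ := far c
  obtain ⟨hm, hcard⟩ := four_multipacking G hG a b c u hab hac (by omega) hu
  have : 4 ≤ multipackingNumber G := by
    refine le_csSup ⟨Fintype.card V, ?_⟩ ⟨_, hm, hcard⟩
    rintro n ⟨P, -, rfl⟩
    rw [← Nat.card_eq_fintype_card]
    exact Set.ncard_le_card P
  omega
end

section
/- Let G be a finite connected nonempty simple graph. If mp(G) ≥ 4, then γ_b(G) ≤ 3·mp(G) − 4. -/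
theorem exists_isometric_seq {V : Type*} (G : SimpleGraph V) (hG : G.Connected)
    (x y : V) (L : ℕ) (hL : L ≤ G.dist x y) :
    ∃ u : ℕ → V, ∀ i j, i ≤ j → j ≤ L → G.dist (u i) (u j) = j - i := by
  obtain ⟨p, hp⟩ := hG.exists_walk_length_eq_dist x y
  have key : ∀ k i, i + k ≤ p.length → G.dist (p.getVert i) (p.getVert (i + k)) ≤ k := by
    intro k
    induction k with
    | zero => intro i _; simp
    | succ k ih =>
      intro i hi
      have h1 := ih i (by omega)
      have h2 : G.dist (p.getVert (i + k)) (p.getVert (i + k + 1)) = 1 :=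
        SimpleGraph.dist_eq_one_iff_adj.2 (p.adj_getVert_succ (by omega))
      have h3 := hG.dist_triangle (u := p.getVert i) (v := p.getVert (i + k))
        (w := p.getVert (i + k + 1))
      rw [← Nat.add_assoc]
      omega
  refine ⟨p.getVert, fun i j hij hj => ?_⟩
  have a := key i 0 (by omega)
  have b := key (j - i) i (by omega)
  have c := key (p.length - j) j (by omega)
  rw [show i + (j - i) = j by omega] at b
  rw [show j + (p.length - j) = p.length by omega, SimpleGraph.Walk.getVert_length] at c
  rw [Nat.zero_add, SimpleGraph.Walk.getVert_zero] at a
  have t1 := hG.dist_triangle (u := x) (v := p.getVert i) (w := y)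
  have t2 := hG.dist_triangle (u := p.getVert i) (v := p.getVert j) (w := y)
  omega

theorem exists_far {V : Type*} [Fintype V] (G : SimpleGraph V) (k : ℕ) (hk : 1 ≤ k)
    (h : k < broadcastNumber G) (c : V) : ∃ z, k < G.dist z c := by
  classical
  by_contra hcon
  push Not at hcon
  have : broadcastNumber G ≤ k := by
    apply Nat.sInf_le
    refine ⟨fun v => if v = c then k else 0, fun u => ⟨c, by simpa using hk, by simpa using hcon u⟩, by simp⟩
  omega

theorem card_bound (I : Finset ℕ) (r n : ℕ) (hr : 1 ≤ r) (hI : ∀ i ∈ I, i ≤ n)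
    (h : ∀ i ∈ I, ∀ j ∈ I, i ≤ j → 3 * (j - i) ≤ 2 * r) :
    I.card ≤ r ∧ ((∀ i ∈ I, 4 ≤ 2 * r ∧ (i < n → 5 ≤ 2 * r) ∧ (1 ≤ i → i < n → 7 ≤ 2 * r)) →
      I.card ≤ r - 1) := by
  rcases I.eq_empty_or_nonempty with rfl | hne
  · simp
  obtain ⟨a, ha, hmin⟩ : ∃ a ∈ I, ∀ b ∈ I, a ≤ b :=
    ⟨I.min' hne, I.min'_mem hne, fun b hb => I.min'_le b hb⟩
  have hcard : I.card ≤ 2 * r / 3 + 1 := by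
    have : I ⊆ Finset.Icc a (a + 2 * r / 3) := by
      intro b hb
      have := h a ha b hb (hmin b hb)
      have := hmin b hb
      rw [Finset.mem_Icc]
      omega
    have := Finset.card_le_card this
    rw [Nat.card_Icc] at this
    omega
  refine ⟨by omega, fun hz => ?_⟩
  have hza := hz a ha
  by_cases h4 : 4 ≤ r
  · omega
  have hr23 : r = 2 ∨ r = 3 := by omega
  rcases hr23 with rfl | rfl
  · have : I ⊆ {a} := by
      intro b hb
      have := h a ha b hb (hmin b hb)
      have := hmin b hb
      have := hI b hb
      rw [Finset.mem_singleton]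
      omega
    simpa using Finset.card_le_card this
  · by_cases h1 : a + 1 ∈ I
    · have : I ⊆ {a, a + 1} := by
        intro b hb
        have := h a ha b hb (hmin b hb)
        have := hmin b hb
        have := hI b hb
        have := hz _ h1
        simp only [Finset.mem_insert, Finset.mem_singleton]
        omega
      exact (Finset.card_le_card this).trans Finset.card_le_two
    · have : I ⊆ {a, a + 2} := by
        intro b hb
        have := h a ha b hb (hmin b hb)
        have := hmin b hb
        have : b ≠ a + 1 := fun hh => h1 (hh ▸ hb)
        simp only [Finset.mem_insert, Finset.mem_singleton]
        omega
      exact (Finset.card_le_card this).trans Finset.card_le_two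

theorem exists_big_multipacking {V : Type*} [Fintype V] (G : SimpleGraph V) (hG : G.Connected)
    (n : ℕ) (hn : 3 ≤ n) (u : ℕ → V)
    (hu : ∀ i j, i ≤ j → j ≤ 3 * n → G.dist (u i) (u j) = j - i)
    (z : V) (hz : 3 * n ≤ G.dist z (u 4)) :
    ∃ P : Set V, isMultipacking G P ∧ P.ncard = n + 2 := by
  classical
  have hzd : ∀ i, i ≤ n → 4 ≤ G.dist z (u (3 * i)) ∧ (i < n → 5 ≤ G.dist z (u (3 * i))) ∧
      (1 ≤ i → i < n → 7 ≤ G.dist z (u (3 * i))) := by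
    intro i hi
    have t := hG.dist_triangle (u := z) (v := u (3 * i)) (w := u 4)
    rcases Nat.le_total (3 * i) 4 with h | h
    · have := hu (3 * i) 4 h (by omega)
      omega
    · have := hu 4 (3 * i) h (by omega)
      rw [SimpleGraph.dist_comm] at this
      omega
  have hinj : Set.InjOn (fun i => u (3 * i)) (Finset.range (n + 1) : Set ℕ) := by
    intro i hi j hj hij
    simp only [Finset.coe_range, Set.mem_Iio] at hi hj hij
    rcases Nat.le_total i j with h | h
    · have := hu (3 * i) (3 * j) (by omega) (by omega)
      rw [hij, SimpleGraph.dist_self] at this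
      omega
    · have := hu (3 * j) (3 * i) (by omega) (by omega)
      rw [hij, SimpleGraph.dist_self] at this
      omega
  have hznot : z ∉ (Finset.range (n + 1)).image (fun i => u (3 * i)) := by
    intro hmem
    obtain ⟨i, hi, rfl⟩ := Finset.mem_image.1 hmem
    rw [Finset.mem_range] at hi
    have := (hzd i (by omega)).1
    simp at this
  refine ⟨↑(insert z ((Finset.range (n + 1)).image (fun i => u (3 * i)))), ?_, ?_⟩
  · intro v r hr
    set I := (Finset.range (n + 1)).filter (fun i => G.dist (u (3 * i)) v ≤ r) with hIdef
    have hImem : ∀ i ∈ I, i ≤ n ∧ G.dist (u (3 * i)) v ≤ r := by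
      intro i hi
      rw [hIdef, Finset.mem_filter, Finset.mem_range] at hi
      exact ⟨by omega, hi.2⟩
    obtain ⟨c1, c2⟩ := card_bound I r n hr (fun i hi => (hImem i hi).1) (by
      intro i hi j hj hij
      have h1 := hImem i hi
      have h2 := hImem j hj
      have := hu (3 * i) (3 * j) (by omega) (by omega)
      have t := hG.dist_triangle (u := u (3 * i)) (v := v) (w := u (3 * j))
      rw [SimpleGraph.dist_comm (u := v)] at t
      omega)
    have himg : (I.image (fun i => u (3 * i))).card ≤ I.card := Finset.card_image_le
    by_cases hzv : G.dist z v ≤ r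
    · have c3 := c2 (by
        intro i hi
        have h1 := hImem i hi
        have h2 := hzd i h1.1
        have t := hG.dist_triangle (u := z) (v := v) (w := u (3 * i))
        rw [SimpleGraph.dist_comm (u := v)] at t
        omega)
      have hsub : {w ∈ (↑(insert z ((Finset.range (n + 1)).image (fun i => u (3 * i)))) : Set V) |
          G.dist w v ≤ r} ⊆ ↑(insert z (I.image (fun i => u (3 * i)))) := by
        rintro w ⟨hw, hwr⟩
        rw [Finset.mem_coe, Finset.mem_insert] at hw ⊢
        rcases hw with rfl | hw
        · exact Or.inl rfl
        · obtain ⟨i, hi, rfl⟩ := Finset.mem_image.1 hw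
          exact Or.inr (Finset.mem_image.2 ⟨i, Finset.mem_filter.2 ⟨hi, hwr⟩, rfl⟩)
      have := Set.ncard_le_ncard hsub (Finset.finite_toSet _)
      rw [Set.ncard_coe_finset] at this
      have := Finset.card_insert_le z (I.image (fun i => u (3 * i)))
      omega
    · have hsub : {w ∈ (↑(insert z ((Finset.range (n + 1)).image (fun i => u (3 * i)))) : Set V) |
          G.dist w v ≤ r} ⊆ ↑(I.image (fun i => u (3 * i))) := by
        rintro w ⟨hw, hwr⟩
        rw [Finset.mem_coe, Finset.mem_insert] at hw
        rw [Finset.mem_coe]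
        rcases hw with rfl | hw
        · exact absurd hwr hzv
        · obtain ⟨i, hi, rfl⟩ := Finset.mem_image.1 hw
          exact Finset.mem_image.2 ⟨i, Finset.mem_filter.2 ⟨hi, hwr⟩, rfl⟩
      have := Set.ncard_le_ncard hsub (Finset.finite_toSet _)
      rw [Set.ncard_coe_finset] at this
      omega
  · rw [Set.ncard_coe_finset, Finset.card_insert_of_notMem hznot,
      Finset.card_image_of_injOn hinj, Finset.card_range]

/-- If `mp(G) ≥ 4` then `γ_b(G) ≤ 3·mp(G) − 4`. -/
theorem broadcast_le_three_mul_multipacking_sub_four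
    {V : Type*} [Fintype V] [Nonempty V] (G : SimpleGraph V) (hG : G.Connected)
    (h : 4 ≤ multipackingNumber G) :
    broadcastNumber G ≤ 3 * multipackingNumber G - 4 := by
  by_contra hcon
  push Not at hcon
  obtain ⟨c⟩ := ‹Nonempty V›
  obtain ⟨x, hx⟩ := exists_far G _ (by omega) hcon c
  obtain ⟨u, hu⟩ := exists_isometric_seq G hG x c (3 * (multipackingNumber G - 1)) (by omega)
  obtain ⟨z, hz⟩ := exists_far G _ (by omega) hcon (u 4)
  have hP := exists_big_multipacking G hG (multipackingNumber G - 1) (by omega) u hu z (by omega)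
  have hle : multipackingNumber G - 1 + 2 ≤ multipackingNumber G := by
    suffices hb : BddAbove {n : ℕ | ∃ P : Set V, isMultipacking G P ∧ P.ncard = n} from
      le_csSup hb (show _ ∈ {n : ℕ | ∃ P : Set V, isMultipacking G P ∧ P.ncard = n} from hP)
    refine ⟨Fintype.card V, ?_⟩
    rintro m ⟨P, -, rfl⟩
    rw [← Nat.card_eq_fintype_card]
    exact Set.ncard_le_card P
  omega
end

section
/- Let G be a finite connected nonempty simple graph. If mp(G) ≤ 4, then γ_b(G) ≤ 2·mp(G). -/
lemma aux_le_mp {V : Type*} [Fintype V] (G : SimpleGraph V) {n : ℕ} (p : Fin n → V)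
    (hp : ∀ v : V, ∀ r : ℕ, 1 ≤ r →
      (Finset.univ.filter (fun i => G.dist (p i) v ≤ r)).card ≤ r) :
    n ≤ multipackingNumber G := by
  classical
  have hinj : Function.Injective p := by
    intro i j hij
    by_contra hne
    have h1 := hp (p i) 1 le_rfl
    have h2 : ({i, j} : Finset (Fin n)) ⊆
        Finset.univ.filter (fun k => G.dist (p k) (p i) ≤ 1) := by
      intro k hk
      simp only [Finset.mem_insert, Finset.mem_singleton] at hk
      rcases hk with rfl | rfl
      · simp
      · simp [hij]
    have h3 := Finset.card_le_card h2
    rw [Finset.card_pair hne] at h3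
    omega
  unfold multipackingNumber
  apply le_csSup
  · refine ⟨Fintype.card V, ?_⟩
    rintro m ⟨P, -, rfl⟩
    rw [← Nat.card_eq_fintype_card]
    exact Set.ncard_le_card P
  · refine ⟨Set.range p, ?_, ?_⟩
    · intro v r hr
      refine le_trans ?_ (hp v r hr)
      have : {u ∈ Set.range p | G.dist u v ≤ r} =
          p '' (↑(Finset.univ.filter (fun i => G.dist (p i) v ≤ r)) : Set (Fin n)) := by
        ext u
        simp only [Set.mem_ofPred_eq, Set.mem_range, Set.mem_image, Finset.coe_filter,
          Finset.mem_univ, true_and]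
        constructor
        · rintro ⟨⟨i, rfl⟩, h⟩
          exact ⟨i, h, rfl⟩
        · rintro ⟨i, h, rfl⟩
          exact ⟨⟨i, rfl⟩, h⟩
      rw [this, Set.ncard_image_of_injective _ hinj, Set.ncard_coe_finset]
    · rw [← Set.image_univ, Set.ncard_image_of_injective _ hinj]
      simp [Set.ncard_univ]

lemma aux_tri {V : Type*} (G : SimpleGraph V) (hG : G.Connected) (a b v : V) :
    G.dist a b ≤ G.dist a v + G.dist b v := by
  rw [G.dist_comm (u := b)]
  exact hG.dist_triangle

lemma aux_mid {V : Type*} (G : SimpleGraph V) (hG : G.Connected) (a b : V) (i : ℕ)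
    (hi : i ≤ G.dist a b) : ∃ w, G.dist a w = i ∧ G.dist w b = G.dist a b - i := by
  obtain ⟨q, hq⟩ := hG.exists_walk_length_eq_dist a b
  refine ⟨q.getVert i, ?_⟩
  have h1 := SimpleGraph.dist_le (q.take i)
  have h2 := SimpleGraph.dist_le (q.drop i)
  have h3 : G.dist a b ≤ G.dist a (q.getVert i) + G.dist (q.getVert i) b := hG.dist_triangle
  simp only [SimpleGraph.Walk.take_length, SimpleGraph.Walk.drop_length] at h1 h2
  omega

lemma aux_far {V : Type*} [Fintype V] (G : SimpleGraph V) (R : ℕ)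
    (hR : 1 ≤ R) (hb : R < broadcastNumber G) (c : V) : ∃ x, R + 1 ≤ G.dist x c := by
  classical
  by_contra! hc
  have : broadcastNumber G ≤ R := by
    apply Nat.sInf_le
    refine ⟨Pi.single c R, ?_, by simp⟩
    intro u
    refine ⟨c, by simpa using hR, ?_⟩
    have := hc u
    simp only [Pi.single_eq_same]
    omega
  omega

lemma aux_far2 {V : Type*} [Fintype V] (G : SimpleGraph V)
    (hb : 4 < broadcastNumber G) (a b : V) : ∃ x, 3 ≤ G.dist x a ∧ 3 ≤ G.dist x b := by
  classical
  by_contra! hc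
  have : broadcastNumber G ≤ 4 := by
    apply Nat.sInf_le
    refine ⟨Pi.single a 2 + Pi.single b 2, ?_, by simp [Finset.sum_add_distrib]⟩
    intro u
    by_cases h : 3 ≤ G.dist u a
    · refine ⟨b, by simp, ?_⟩
      have := hc u h
      simp only [Pi.add_apply, Pi.single_eq_same]
      omega
    · refine ⟨a, by simp only [Pi.add_apply, Pi.single_eq_same]; omega, ?_⟩
      simp only [Pi.add_apply, Pi.single_eq_same]
      omega
  omega

/-- If `mp(G) ≤ 4` then `γ_b(G) ≤ 2·mp(G)`. -/
theorem broadcast_le_two_mul_multipacking_of_multipacking_le_four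
    {V : Type*} [Fintype V] [Nonempty V] (G : SimpleGraph V) (hG : G.Connected)
    (h : multipackingNumber G ≤ 4) :
    broadcastNumber G ≤ 2 * multipackingNumber G := by
  by_contra! hb
  have T := fun a b c => hG.dist_triangle (u := a) (v := b) (w := c)
  obtain ⟨o⟩ := ‹Nonempty V›
  have hm : 1 ≤ multipackingNumber G := by
    apply aux_le_mp G ![o]
    intro v r hr
    rw [Finset.card_filter, Fin.sum_univ_one]
    split_ifs <;> omega
  obtain ⟨z, hz⟩ := aux_far G _ (by omega) hb o
  have hcases : multipackingNumber G = 1 ∨ multipackingNumber G = 2 ∨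
    multipackingNumber G = 3 ∨ multipackingNumber G = 4 := by omega
  rcases hcases with hk | hk | hk | hk
  · rw [hk] at hz
    have key : 2 ≤ multipackingNumber G := by
      apply aux_le_mp G ![z, o]
      intro v r hr
      have t01 := aux_tri G hG z o v
      rw [Finset.card_filter, Fin.sum_univ_two]
      simp only [Matrix.cons_val]
      by_cases q0 : G.dist z v ≤ r <;>
        by_cases q1 : G.dist o v ≤ r <;>
        simp only [q0, q1, ↓reduceIte] <;> omega
    omega
  · rw [hk] at hz hb
    obtain ⟨x, hx1, hx2⟩ := aux_far2 G hb o z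
    have e1 := G.dist_comm (u := o) (v := x)
    have key : 3 ≤ multipackingNumber G := by
      apply aux_le_mp G ![x, z, o]
      intro v r hr
      have t01 := aux_tri G hG x z v
      have t02 := aux_tri G hG x o v
      have t12 := aux_tri G hG z o v
      rw [Finset.card_filter, Fin.sum_univ_three]
      simp only [Matrix.cons_val]
      by_cases q0 : G.dist x v ≤ r <;>
        by_cases q1 : G.dist z v ≤ r <;>
        by_cases q2 : G.dist o v ≤ r <;>
        simp only [q0, q1, q2, ↓reduceIte] <;> omega
    omega
  · rw [hk] at hz hb
    obtain ⟨a, ha1, -⟩ := aux_mid G hG z o 7 (by omega)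
    obtain ⟨b, hb1, hb2⟩ := aux_mid G hG z a 3 (by omega)
    obtain ⟨x, hx⟩ := aux_far G _ (by omega) hb b
    have c1 := G.dist_comm (u := a) (v := b)
    have s0 := hG.dist_triangle (u := x) (v := z) (w := b)
    have s1 := hG.dist_triangle (u := x) (v := a) (w := b)
    have key : 4 ≤ multipackingNumber G := by
      apply aux_le_mp G ![x, z, b, a]
      intro v r hr
      have t01 := aux_tri G hG x z v
      have t02 := aux_tri G hG x b v
      have t12 := aux_tri G hG z b v
      have t03 := aux_tri G hG x a v
      have t13 := aux_tri G hG z a v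
      have t23 := aux_tri G hG b a v
      rw [Finset.card_filter, Fin.sum_univ_four]
      simp only [Matrix.cons_val]
      by_cases q0 : G.dist x v ≤ r <;>
        by_cases q1 : G.dist z v ≤ r <;>
        by_cases q2 : G.dist b v ≤ r <;>
        by_cases q3 : G.dist a v ≤ r <;>
        simp only [q0, q1, q2, q3, ↓reduceIte] <;> omega
    omega
  · rw [hk] at hz hb
    obtain ⟨a, ha1, -⟩ := aux_mid G hG z o 9 (by omega)
    obtain ⟨b, hb1, hb2⟩ := aux_mid G hG z a 6 (by omega)
    obtain ⟨c, hc1, hc2⟩ := aux_mid G hG z b 3 (by omega)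
    obtain ⟨d, hd1, hd2⟩ := aux_mid G hG c b 1 (by omega)
    obtain ⟨x, hx⟩ := aux_far G _ (by omega) hb d
    have c1 := G.dist_comm (u := b) (v := d)
    have c2 := G.dist_comm (u := a) (v := b)
    have s0 := hG.dist_triangle (u := x) (v := c) (w := d)
    have s1 := hG.dist_triangle (u := x) (v := b) (w := d)
    have s2 := hG.dist_triangle (u := x) (v := z) (w := c)
    have s3 := hG.dist_triangle (u := x) (v := z) (w := d)
    have s4 := hG.dist_triangle (u := z) (v := c) (w := d)
    have s5 := hG.dist_triangle (u := x) (v := a) (w := b)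
    have s6 := hG.dist_triangle (u := a) (v := b) (w := d)
    have s7 := hG.dist_triangle (u := x) (v := a) (w := d)
    have s8 := hG.dist_triangle (u := z) (v := c) (w := a)
    have key : 5 ≤ multipackingNumber G := by
      apply aux_le_mp G ![x, z, c, b, a]
      intro v r hr
      have t01 := aux_tri G hG x z v
      have t02 := aux_tri G hG x c v
      have t12 := aux_tri G hG z c v
      have t03 := aux_tri G hG x b v
      have t13 := aux_tri G hG z b v
      have t23 := aux_tri G hG c b v
      have t04 := aux_tri G hG x a v
      have t14 := aux_tri G hG z a v
      have t24 := aux_tri G hG c a v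
      have t34 := aux_tri G hG b a v
      rw [Finset.card_filter, Fin.sum_univ_five]
      simp only [Matrix.cons_val]
      by_cases q0 : G.dist x v ≤ r <;>
        by_cases q1 : G.dist z v ≤ r <;>
        by_cases q2 : G.dist c v ≤ r <;>
        by_cases q3 : G.dist b v ≤ r <;>
        by_cases q4 : G.dist a v ≤ r <;>
        simp only [q0, q1, q2, q3, q4, ↓reduceIte] <;> omega
    omega
end

section
/- For every finite connected nonempty simple graph G, the radius satisfies rad(G) ≤ 2·mp(G) + 3; equivalently, mp(G) ≥ (rad(G) − 3)/2. -/
lemma mp_span (S : Finset ℕ) : S.card = 0 ∨ ∃ a ∈ S, ∃ b ∈ S, a ≤ b ∧ S.card ≤ b - a + 1 := by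
  rcases S.eq_empty_or_nonempty with h | h
  · left; simp [h]
  · right
    refine ⟨S.min' h, S.min'_mem h, S.max' h, S.max'_mem h, S.min'_le _ (S.max'_mem h), ?_⟩
    have hs : S ⊆ Finset.Icc (S.min' h) (S.max' h) := fun x hx =>
      Finset.mem_Icc.2 ⟨S.min'_le _ hx, S.le_max' _ hx⟩
    have := Finset.card_le_card hs
    have h2 := S.min'_le _ (S.max'_mem h)
    rw [Nat.card_Icc] at this
    omega

lemma mp_comb (k r : ℕ) (hr : 1 ≤ r) (T : Finset ℕ)
    (h1 : ∀ s ∈ T, ∀ t ∈ T, s ≤ t → t < 2 * k → 3 * t ≤ 2 * r + 3 * s)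
    (h2 : ∀ s ∈ T, ∀ t ∈ T, 2 * k ≤ s → s ≤ t → 3 * t ≤ 2 * r + 3 * s)
    (h3 : ∀ s ∈ T, ∀ t ∈ T, s < k → 2 * k ≤ t → 3 * s + 3 * t + 3 ≤ 2 * r + 6 * k)
    (h4 : ∀ s ∈ T, ∀ t ∈ T, k ≤ s → s < 2 * k → 2 * k ≤ t → 3 * t + 3 ≤ 2 * r + 3 * s) :
    T.card ≤ r := by
  have e1 := Finset.card_filter_add_card_filter_not (s := T) (fun t => t < 2 * k)
  have e2 := Finset.card_filter_add_card_filter_not (s := T.filter (fun t => t < 2 * k))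
    (fun t => t < k)
  have m1 := mp_span ((T.filter (fun t => t < 2 * k)).filter (fun t => t < k))
  have m2 := mp_span ((T.filter (fun t => t < 2 * k)).filter (fun t => ¬ t < k))
  have m3 := mp_span (T.filter (fun t => ¬ t < 2 * k))
  generalize ((T.filter (fun t => t < 2 * k)).filter (fun t => t < k)).card = c1 at *
  generalize ((T.filter (fun t => t < 2 * k)).filter (fun t => ¬ t < k)).card = c2 at *
  generalize (T.filter (fun t => ¬ t < 2 * k)).card = c3 at *
  simp only [Finset.mem_filter] at m1 m2 m3
  rcases m1 with m1 | ⟨a, ⟨⟨ha, ha1⟩, ha2⟩, b, ⟨⟨hb, hb1⟩, hb2⟩, hab, m1⟩ <;>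
  rcases m2 with m2 | ⟨c, ⟨⟨hc, hc1⟩, hc2⟩, d, ⟨⟨hd, hd1⟩, hd2⟩, hcd, m2⟩ <;>
  rcases m3 with m3 | ⟨e, ⟨he, he1⟩, f, ⟨hf, hf1⟩, hef, m3⟩
  · omega
  · have := h2 e he f hf; omega
  · have := h1 c hc d hd; omega
  · have := h4 c hc f hf; omega
  · have := h1 a ha b hb; omega
  · have := h3 b hb f hf; omega
  · have := h1 a ha d hd; omega
  · have := h1 a ha d hd
    have := h4 c hc f hf
    have := h3 b hb f hf
    omega

lemma mp_geod {V : Type*} (G : SimpleGraph V) (hG : G.Connected) (u v : V) :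
    ∃ p : ℕ → V, p 0 = u ∧ ∀ a b, a ≤ b → b ≤ G.dist u v → G.dist (p a) (p b) = b - a := by
  obtain ⟨w, hw⟩ := hG.exists_walk_length_eq_dist u v
  have up : ∀ a n, a + n ≤ w.length → G.dist (w.getVert a) (w.getVert (a + n)) ≤ n := by
    intro a n
    induction n with
    | zero => simp
    | succ n ih =>
      intro h
      have h1 := ih (by omega)
      have h2 := SimpleGraph.dist_eq_one_iff_adj.2 (w.adj_getVert_succ (i := a + n) (by omega))
      have h3 := hG.dist_triangle (u := w.getVert a) (v := w.getVert (a + n))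
        (w := w.getVert (a + n + 1))
      rw [← add_assoc]
      omega
  refine ⟨w.getVert, by simp, fun a b hab hb => ?_⟩
  have h1 := up 0 a (by omega)
  have h2 := up a (b - a) (by omega)
  have h3 := up b (w.length - b) (by omega)
  rw [show a + (b - a) = b by omega] at h2
  rw [show b + (w.length - b) = w.length by omega, w.getVert_length] at h3
  rw [zero_add, w.getVert_zero] at h1
  have h4 := hG.dist_triangle (u := u) (v := w.getVert a) (w := v)
  have h5 := hG.dist_triangle (u := w.getVert a) (v := w.getVert b) (w := v)
  omega

lemma mp_le {V : Type*} [Fintype V] (G : SimpleGraph V) (P : Set V) (h : isMultipacking G P) :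
    P.ncard ≤ multipackingNumber G := by
  refine le_csSup ⟨Fintype.card V, ?_⟩ ⟨P, h, rfl⟩
  rintro n ⟨Q, -, rfl⟩
  rw [← Nat.card_eq_fintype_card]
  exact Set.ncard_le_card Q

lemma mp_key {V : Type*} [Fintype V] (G : SimpleGraph V) (hG : G.Connected) (k l L : ℕ)
    (p q : ℕ → V) (hpq : q 0 = p (3 * k)) (hL : l = 0 ∨ 3 * k + 3 * l ≤ L)
    (hp : ∀ a b, a ≤ b → b ≤ 6 * k → G.dist (p a) (p b) = b - a)
    (hq : ∀ a b, a ≤ b → b ≤ L → G.dist (q a) (q b) = b - a) :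
    2 * k + l ≤ multipackingNumber G := by
  classical
  set f : ℕ → V := fun t => if t < 2 * k then p (3 * t) else q (3 * k + 3 * (t - 2 * k + 1))
    with hf
  have f1 : ∀ t, t < 2 * k → f t = p (3 * t) := fun t h => by simp [hf, h]
  have f2 : ∀ t, 2 * k ≤ t → f t = q (3 * k + 3 * (t - 2 * k + 1)) := fun t h => by
    simp [hf, not_lt.2 h]
  have d1 : ∀ s t, s ≤ t → t < 2 * k → G.dist (f s) (f t) = 3 * t - 3 * s := by
    intro s t h1 h2
    rw [f1 s (by omega), f1 t h2, hp _ _ (by omega) (by omega)]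
  have d2 : ∀ s t, 2 * k ≤ s → s ≤ t → t < 2 * k + l → G.dist (f s) (f t) = 3 * t - 3 * s := by
    intro s t h1 h2 h3
    rw [f2 s h1, f2 t (by omega), hq _ _ (by omega) (by omega)]
    omega
  have dx : ∀ t, 2 * k ≤ t → t < 2 * k + l →
      G.dist (p (3 * k)) (f t) = 3 * k + 3 * (t - 2 * k + 1) := by
    intro t h1 h2
    rw [f2 t h1, ← hpq, hq _ _ (by omega) (by omega)]
    omega
  have d3 : ∀ s t, s < k → 2 * k ≤ t → t < 2 * k + l →
      3 * s + 3 * t + 3 ≤ G.dist (f s) (f t) + 6 * k := by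
    intro s t h1 h2 h3
    have e1 := dx t h2 h3
    have e2 := hG.dist_triangle (u := p (3 * k)) (v := f s) (w := f t)
    have e3 := hp (3 * s) (3 * k) (by omega) (by omega)
    rw [SimpleGraph.dist_comm, ← f1 s (by omega)] at e3
    omega
  have d4 : ∀ s t, k ≤ s → s < 2 * k → 2 * k ≤ t → t < 2 * k + l →
      3 * t + 3 ≤ G.dist (f s) (f t) + 3 * s := by
    intro s t h0 h1 h2 h3
    have e1 := dx t h2 h3
    have e2 := hG.dist_triangle (u := p (3 * k)) (v := f s) (w := f t)
    have e3 := hp (3 * k) (3 * s) (by omega) (by omega)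
    rw [← f1 s (by omega)] at e3
    omega
  have inj' : ∀ s t, s < t → t < 2 * k + l → f s ≠ f t := by
    intro s t h1 h2 h
    have h0 : G.dist (f s) (f t) = 0 := by rw [h]; simp
    have := d1 s t
    have := d2 s t
    have := d3 s t
    have := d4 s t
    omega
  have inj : Set.InjOn f (Finset.range (2 * k + l) : Set ℕ) := by
    intro s hs t ht h
    simp only [Finset.coe_range, Set.mem_Iio] at hs ht
    rcases lt_trichotomy s t with h1 | h1 | h1
    · exact absurd h (inj' s t h1 ht)
    · exact h1
    · exact absurd h.symm (inj' t s h1 hs)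
  have hc : (f '' (Finset.range (2 * k + l) : Set ℕ)).ncard = 2 * k + l := by
    rw [Set.InjOn.ncard_image inj, Set.ncard_coe_finset, Finset.card_range]
  rw [← hc]
  apply mp_le
  intro v r hr
  set T := (Finset.range (2 * k + l)).filter (fun t => G.dist (f t) v ≤ r) with hT
  have hsub : {u ∈ f '' (Finset.range (2 * k + l) : Set ℕ) | G.dist u v ≤ r} ⊆ f '' (T : Set ℕ) := by
    rintro u ⟨⟨t, ht, rfl⟩, hu⟩
    refine ⟨t, ?_, rfl⟩
    simp only [hT, Finset.coe_filter, Set.mem_setOf_eq]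
    exact ⟨by simpa using ht, hu⟩
  refine (Set.ncard_le_ncard hsub (Set.toFinite _)).trans ?_
  refine (Set.ncard_image_le (Set.toFinite _)).trans ?_
  rw [Set.ncard_coe_finset]
  have hlt : ∀ t ∈ T, t < 2 * k + l := fun t ht => by
    simpa using (Finset.mem_filter.1 ht).1
  have hd : ∀ s ∈ T, ∀ t ∈ T, G.dist (f s) (f t) ≤ 2 * r := by
    intro s hs t ht
    have a1 := (Finset.mem_filter.1 hs).2
    have a2 := (Finset.mem_filter.1 ht).2
    have a3 := hG.dist_triangle (u := f s) (v := v) (w := f t)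
    rw [SimpleGraph.dist_comm] at a2
    omega
  apply mp_comb k r hr T
  · intro s hs t ht h1 h2
    have := hd s hs t ht
    have := d1 s t h1 h2
    omega
  · intro s hs t ht h1 h2
    have := hd s hs t ht
    have := d2 s t h1 h2 (hlt t ht)
    omega
  · intro s hs t ht h1 h2
    have := hd s hs t ht
    have := d3 s t h1 h2 (hlt t ht)
    omega
  · intro s hs t ht h1 h2 h3
    have := hd s hs t ht
    have := d4 s t h1 h2 h3 (hlt t ht)
    omega

/-- For every finite connected nonempty simple graph, `rad(G) ≤ 2·mp(G) + 3`. -/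
theorem radius_le_two_mul_multipacking_add_three
    {V : Type*} [Fintype V] [Nonempty V] (G : SimpleGraph V) (hG : G.Connected) :
    graphRadius G ≤ 2 * multipackingNumber G + 3 := by
  have hecc : ∀ x : V, ∃ y : V, graphRadius G ≤ G.dist x y := by
    intro x
    obtain ⟨y, -, hy⟩ := Finset.exists_mem_eq_sup (Finset.univ : Finset V)
      Finset.univ_nonempty (fun u : V => G.dist u x)
    refine ⟨y, ?_⟩
    rw [SimpleGraph.dist_comm, ← hy]
    exact Nat.sInf_le ⟨x, rfl⟩
  obtain ⟨⟨u, v⟩, huv⟩ := Finite.exists_max (fun z : V × V => G.dist z.1 z.2)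
  simp only [Prod.forall] at huv
  obtain ⟨p, -, hp⟩ := mp_geod G hG u v
  set k := G.dist u v / 6 with hk
  obtain ⟨y, hy⟩ := hecc (p (3 * k))
  obtain ⟨q, hq0, hq⟩ := mp_geod G hG (p (3 * k)) y
  have hy2 := huv (p (3 * k)) y
  have := mp_key G hG k ((graphRadius G - 3 * k) / 3) (G.dist (p (3 * k)) y) p q hq0
    (by omega) (fun a b h1 h2 => hp a b h1 (by omega)) hq
  omega
end

section
/- Let G be a finite connected nonempty simple graph. If every vertex of G has eccentricity at least 3p − 3 for some integer p ≥ 4, and there exists no dominating broadcast of G of cost less than 3p − 3, then G admits a multipacking of size p + 1; in particular mp(G) ≥ p + 1. -/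
theorem exists_far_of_ecc {V : Type*} [Fintype V] [Nonempty V] (G : SimpleGraph V) (v : V) (k : ℕ)
    (h : k ≤ eccentricity G v) : ∃ u, k ≤ G.dist u v := by
  obtain ⟨u, _, hu⟩ := Finset.exists_mem_eq_sup (Finset.univ : Finset V) Finset.univ_nonempty
    (fun u : V => G.dist u v)
  exact ⟨u, by rw [← hu]; exact h⟩

theorem exists_geodesic {V : Type*} (G : SimpleGraph V) (hG : G.Connected) (x y : V) :
    ∃ w : ℕ → V, ∀ i j, i ≤ j → j ≤ G.dist x y → G.dist (w i) (w j) = j - i := by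
  obtain ⟨q, hq⟩ := hG.exists_walk_length_eq_dist x y
  have key : ∀ i n, G.dist (q.getVert i) (q.getVert (i + n)) ≤ n := by
    intro i n
    induction n with
    | zero => simp
    | succ n ih =>
      have h1 : G.dist (q.getVert (i + n)) (q.getVert (i + (n + 1))) ≤ 1 := by
        by_cases h : i + n < q.length
        · exact (SimpleGraph.dist_eq_one_iff_adj.mpr (q.adj_getVert_succ h)).le
        · rw [q.getVert_of_length_le (by omega), q.getVert_of_length_le (by omega)]
          simp
      have := hG.dist_triangle (u := q.getVert i) (v := q.getVert (i + n))
        (w := q.getVert (i + (n + 1)))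
      omega
  refine ⟨q.getVert, fun i j hij hj => ?_⟩
  have a := key 0 i
  have b := key i (j - i)
  have c := key j (q.length - j)
  rw [show i + (j - i) = j by omega] at b
  rw [show j + (q.length - j) = q.length by omega, q.getVert_length] at c
  rw [Nat.zero_add, q.getVert_zero] at a
  have t1 := hG.dist_triangle (u := x) (v := q.getVert i) (w := y)
  have t2 := hG.dist_triangle (u := q.getVert i) (v := q.getVert j) (w := y)
  omega

/-- If every vertex has eccentricity at least `3p − 3` for some `p ≥ 4` and there is no
dominating broadcast of cost less than `3p − 3`, then `G` has a multipacking of size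
`p + 1`; in particular `mp(G) ≥ p + 1`. -/
theorem multipacking_of_large_eccentricity_and_broadcast
    {V : Type*} [Fintype V] [Nonempty V] (G : SimpleGraph V) (hG : G.Connected)
    (p : ℕ) (hp : 4 ≤ p)
    (hecc : ∀ v : V, 3 * p - 3 ≤ eccentricity G v)
    (hbr : ∀ f : V → ℕ, isDominatingBroadcast G f → 3 * p - 3 ≤ ∑ v : V, f v) :
    (∃ P : Set V, isMultipacking G P ∧ P.ncard = p + 1) ∧
    p + 1 ≤ multipackingNumber G := by
  classical
  have main : ∃ P : Set V, isMultipacking G P ∧ P.ncard = p + 1 := by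
    obtain ⟨x0⟩ := ‹Nonempty V›
    have : Nonempty V := ⟨x0⟩
    obtain ⟨x1, hx1⟩ := exists_far_of_ecc G x0 _ (hecc x0)
    obtain ⟨w, hw⟩ := exists_geodesic G hG x1 x0
    have hd : ∀ i j, i ≤ j → j ≤ 3 * p - 3 → G.dist (w i) (w j) = j - i :=
      fun i j h1 h2 => hw i j h1 (h2.trans hx1)
    obtain ⟨y, hy⟩ := exists_far_of_ecc G (w ((3 * p - 3) / 2)) _ (hecc _)
    have hm : ∀ i, i < p → G.dist (w (3 * i)) (w ((3 * p - 3) / 2)) ≤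
        (3 * i - (3 * p - 3) / 2) + ((3 * p - 3) / 2 - 3 * i) := by
      intro i hi
      rcases le_total (3 * i) ((3 * p - 3) / 2) with h | h
      · rw [hd _ _ h (by omega)]; omega
      · rw [SimpleGraph.dist_comm, hd _ _ h (by omega)]; omega
    have hinj : ∀ i < p, ∀ j < p, w (3 * i) = w (3 * j) → i = j := by
      intro i hi j hj h
      rcases le_total i j with hij | hij
      · have := hd (3 * i) (3 * j) (by omega) (by omega)
        rw [h, SimpleGraph.dist_self] at this; omega
      · have := hd (3 * j) (3 * i) (by omega) (by omega)
        rw [h, SimpleGraph.dist_self] at this; omega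
    have hyn : y ∉ (Finset.range p).image (fun i => w (3 * i)) := by
      intro h
      obtain ⟨i, hi, rfl⟩ := Finset.mem_image.mp h
      have := hm i (Finset.mem_range.mp hi)
      have := Finset.mem_range.mp hi
      omega
    refine ⟨↑(insert y ((Finset.range p).image (fun i => w (3 * i)))), ?_, ?_⟩
    · intro v r hr
      let S := (Finset.range p).filter (fun i => G.dist (w (3 * i)) v ≤ r)
      let T : Finset V := if G.dist y v ≤ r then {y} else ∅
      have hsub : {u ∈ ((insert y ((Finset.range p).image (fun i => w (3 * i))) : Finset V) : Set V)
          | G.dist u v ≤ r} ⊆ ((T ∪ S.image (fun i => w (3 * i)) : Finset V) : Set V) := by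
        rintro u ⟨hu, hur⟩
        rw [Finset.mem_coe, Finset.mem_insert, Finset.mem_image] at hu
        rw [Finset.mem_coe, Finset.mem_union, Finset.mem_image]
        rcases hu with rfl | ⟨i, hi, rfl⟩
        · left; simp only [T]; rw [if_pos hur]; simp
        · right; exact ⟨i, Finset.mem_filter.mpr ⟨hi, hur⟩, rfl⟩
      have h1 := Set.ncard_le_ncard hsub (Finset.finite_toSet _)
      rw [Set.ncard_coe_finset] at h1
      have h2 := Finset.card_union_le T (S.image (fun i => w (3 * i)))
      have h3 : (S.image (fun i => w (3 * i))).card ≤ S.card := Finset.card_image_le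
      refine h1.trans (h2.trans ?_)
      have hT : T.card ≤ 1 := by simp only [T]; split_ifs <;> simp
      rcases S.eq_empty_or_nonempty with hS | hS
      · rw [hS] at h3 ⊢
        simp only [Finset.card_empty, Finset.image_empty] at h3 ⊢
        omega
      · have ha := Finset.mem_filter.mp (S.min'_mem hS)
        have hb := Finset.mem_filter.mp (S.max'_mem hS)
        have hab := S.min'_le _ (S.max'_mem hS)
        have hc : S.card ≤ S.max' hS + 1 - S.min' hS := by
          rw [← Nat.card_Icc]
          exact Finset.card_le_card fun i hi =>
            Finset.mem_Icc.mpr ⟨S.min'_le _ hi, S.le_max' _ hi⟩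
        generalize S.min' hS = a at *
        generalize S.max' hS = b at *
        obtain ⟨ha1, ha2⟩ := ha
        obtain ⟨hb1, hb2⟩ := hb
        rw [Finset.mem_range] at ha1 hb1
        have e := hd (3 * a) (3 * b) (by omega) (by omega)
        have t := hG.dist_triangle (u := w (3 * a)) (v := v) (w := w (3 * b))
        rw [SimpleGraph.dist_comm (u := v)] at t
        by_cases hyr : G.dist y v ≤ r
        · have ma := hm a ha1
          have mb := hm b hb1
          have ta := hG.dist_triangle (u := y) (v := v) (w := w (3 * a))
          have tb := hG.dist_triangle (u := y) (v := v) (w := w (3 * b))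
          rw [SimpleGraph.dist_comm (u := v)] at ta tb
          have sa := hG.dist_triangle (u := y) (v := w (3 * a)) (w := w ((3 * p - 3) / 2))
          have sb := hG.dist_triangle (u := y) (v := w (3 * b)) (w := w ((3 * p - 3) / 2))
          by_contra hcon
          have hr3 : r ≤ 3 := by omega
          obtain ⟨m, hmm⟩ : ∃ m, m = (3 * p - 3) / 2 := ⟨_, rfl⟩
          rw [← hmm] at ma mb sa sb hy
          have hA : 3 * p - 3 ≤ 2 * r + ((3 * a - m) + (m - 3 * a)) := by omega
          have hB : 3 * p - 3 ≤ 2 * r + ((3 * b - m) + (m - 3 * b)) := by omega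
          have hba : b = a + (r - 1) := by omega
          clear sa sb ta tb ma mb t e hcon h1 h2 h3 hc
          subst hba
          have hr' : r = 1 ∨ r = 2 ∨ r = 3 := by omega
          clear_value S T
          clear hsub
          rcases hr' with rfl | rfl | rfl
          · omega
          · omega
          · have hp4 : p ≤ 4 := by omega
            have hp5 : p = 4 := by omega
            subst hp5
            have ha3 : a = 0 ∨ a = 1 := by omega
            rcases ha3 with rfl | rfl <;> omega
        · have : T.card = 0 := by simp only [T]; rw [if_neg hyr]; rfl
          omega
    · rw [Set.ncard_coe_finset, Finset.card_insert_of_notMem hyn, Finset.card_image_of_injOn,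
        Finset.card_range]
      intro i hi j hj h
      exact hinj i (by simpa using hi) j (by simpa using hj) h
  refine ⟨main, ?_⟩
  obtain ⟨P, hP, hc⟩ := main
  refine le_csSup ⟨Fintype.card V, ?_⟩ ⟨P, hP, hc⟩
  rintro n ⟨Q, _, rfl⟩
  rw [← Nat.card_eq_fintype_card, ← Set.ncard_univ]
  exact Set.ncard_le_ncard (Set.subset_univ _) (Set.toFinite _)
end

section
/- The cycle graph C_5 on 5 vertices satisfies mp(C_5) = 1 and γ_b(C_5) = 2, so γ_b(C_5) = 2·mp(C_5). -/
theorem c5_conn : (SimpleGraph.cycleGraph 5).Connected := SimpleGraph.cycleGraph_connected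

theorem c5_dist_le_one (u v : Fin 5) :
    (SimpleGraph.cycleGraph 5).dist u v ≤ 1 ↔ u = v ∨ (SimpleGraph.cycleGraph 5).Adj u v := by
  rw [Nat.le_one_iff_eq_zero_or_eq_one, c5_conn.dist_eq_zero_iff, SimpleGraph.dist_eq_one_iff_adj]

theorem c5_common (u w : Fin 5) : ∃ v, (SimpleGraph.cycleGraph 5).dist u v ≤ 1 ∧
    (SimpleGraph.cycleGraph 5).dist w v ≤ 1 := by
  simp only [c5_dist_le_one]
  revert u w
  decide

theorem c5_far (v : Fin 5) : ∃ u, ¬ (SimpleGraph.cycleGraph 5).dist u v ≤ 1 := by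
  simp only [c5_dist_le_one]
  revert v
  decide

theorem c5_dist_le_two (u w : Fin 5) : (SimpleGraph.cycleGraph 5).dist u w ≤ 2 := by
  obtain ⟨v, h1, h2⟩ := c5_common u w
  have := c5_conn.dist_triangle (u := u) (v := v) (w := w)
  rw [SimpleGraph.dist_comm (u := v)] at this
  omega

theorem c5_mp : multipackingNumber (SimpleGraph.cycleGraph 5) = 1 := by
  refine IsGreatest.csSup_eq ⟨⟨{0}, ?_, Set.ncard_singleton _⟩, ?_⟩
  · intro v r hr
    refine le_trans (Set.ncard_le_ncard (t := {0}) (fun x hx => hx.1) (Set.toFinite _)) ?_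
    simpa using hr
  · rintro n ⟨P, hP, rfl⟩
    rw [Set.ncard_le_one_iff (Set.toFinite _)]
    intro a b ha hb
    obtain ⟨v, h1, h2⟩ := c5_common a b
    have := hP v 1 le_rfl
    rw [Set.ncard_le_one_iff (Set.toFinite _)] at this
    exact this ⟨ha, h1⟩ ⟨hb, h2⟩

theorem c5_bn : broadcastNumber (SimpleGraph.cycleGraph 5) = 2 := by
  refine IsLeast.csInf_eq ⟨⟨Pi.single 0 2, ?_, by simp⟩, ?_⟩
  · intro u
    exact ⟨0, by simp, by simpa using c5_dist_le_two u 0⟩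
  · rintro c ⟨f, hf, rfl⟩
    by_contra! hlt
    obtain ⟨v, hv, -⟩ := hf 0
    obtain ⟨u, hu⟩ := c5_far v
    obtain ⟨w, hw, hd⟩ := hf u
    have hs := Finset.add_sum_erase Finset.univ f (Finset.mem_univ v)
    by_cases hwv : w = v
    · subst hwv
      omega
    · have := Finset.single_le_sum (f := f) (fun i _ => Nat.zero_le _)
        (Finset.mem_erase.2 ⟨hwv, Finset.mem_univ w⟩)
      omega

/-- The cycle `C₅` has `mp(C₅) = 1` and `γ_b(C₅) = 2`, so `γ_b(C₅) = 2·mp(C₅)`. -/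
theorem cycle_five_multipacking_and_broadcast :
    multipackingNumber (SimpleGraph.cycleGraph 5) = 1 ∧
    broadcastNumber (SimpleGraph.cycleGraph 5) = 2 ∧
    broadcastNumber (SimpleGraph.cycleGraph 5)
      = 2 * multipackingNumber (SimpleGraph.cycleGraph 5) := by
  exact ⟨c5_mp, c5_bn, by rw [c5_mp, c5_bn]⟩
end
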